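/- Let ω = (ω₁, ω₂) be irrational (absence of nonparallel resonances). If (k₁, k₂, k₃, k₄) ∈ R is nondegenerate, then either (k₃, k₄) = ((k₁⁽¹⁾, k₂⁽²⁾), (k₂⁽¹⁾, k₁⁽²⁾)) or (k₃, k₄) = ((k₂⁽¹⁾, k₁⁽²⁾), (k₁⁽¹⁾, k₂⁽²⁾)); that is, the four points k₁, k₂, k₃, k₄ are the vertices of an axis-parallel rectangle in ℤ². -/

import Mathlib

/-- `ω = (ω₁, ω₂)` is irrational: `ω₁m₁ + ω₂m₂ ≠ 0` for every nonzero `(m₁, m₂) ∈ ℤ²`. -/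
def IsIrrationalPair (ω : ℝ × ℝ) : Prop :=
  ∀ m : ℤ × ℤ, m ≠ 0 → ω.1 * (m.1 : ℝ) + ω.2 * (m.2 : ℝ) ≠ 0

/-- The frequency `λ_k = ω₁(k⁽¹⁾)² + ω₂(k⁽²⁾)²` for `k ∈ ℤ²`. -/
noncomputable def freq (ω : ℝ × ℝ) (k : ℤ × ℤ) : ℝ :=
  ω.1 * (k.1 : ℝ) ^ 2 + ω.2 * (k.2 : ℝ) ^ 2

/-- Membership in the resonance set `R`. -/
def InRes (ω : ℝ × ℝ) (k₁ k₂ k₃ k₄ : ℤ × ℤ) : Prop :=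
  k₁ + k₂ = k₃ + k₄ ∧ freq ω k₁ + freq ω k₂ = freq ω k₃ + freq ω k₄

/-- A resonant 4-tuple is degenerate if `(k₃, k₄) = (k₁, k₂)` or `(k₃, k₄) = (k₂, k₁)`. -/
def Degenerate (k₁ k₂ k₃ k₄ : ℤ × ℤ) : Prop :=
  (k₃ = k₁ ∧ k₄ = k₂) ∨ (k₃ = k₂ ∧ k₄ = k₁)

/-- Two integers are determined, up to order, by their sum and the sum of their squares. -/
theorem Int.eq_and_eq_or_eq_and_eq_of_add_eq_of_sq_add_sq_eq {a b c d : ℤ}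
    (h : a + b = c + d) (hsq : a ^ 2 + b ^ 2 = c ^ 2 + d ^ 2) :
    (c = a ∧ d = b) ∨ (c = b ∧ d = a) := by
  have hprod : (c - a) * (c - b) = 0 := by
    obtain rfl : d = a + b - c := by lia
    linarith
  rcases mul_eq_zero.mp hprod with hc | hc <;> lia

/-- For an irrational `ω`, resonance holds in each coordinate separately. -/
theorem InRes.sq_add_sq_eq {ω : ℝ × ℝ} (hirr : IsIrrationalPair ω) {k₁ k₂ k₃ k₄ : ℤ × ℤ}
    (h : InRes ω k₁ k₂ k₃ k₄) :
    k₁.1 ^ 2 + k₂.1 ^ 2 = k₃.1 ^ 2 + k₄.1 ^ 2 ∧ k₁.2 ^ 2 + k₂.2 ^ 2 = k₃.2 ^ 2 + k₄.2 ^ 2 := by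
  have hm : ((k₁.1 ^ 2 + k₂.1 ^ 2 - (k₃.1 ^ 2 + k₄.1 ^ 2),
      k₁.2 ^ 2 + k₂.2 ^ 2 - (k₃.2 ^ 2 + k₄.2 ^ 2)) : ℤ × ℤ) = 0 := by
    by_contra hne
    apply hirr _ hne
    have hfreq := h.2
    simp only [freq] at hfreq
    push_cast
    linarith
  simpa only [Prod.mk_eq_zero, sub_eq_zero] using hm

/-- Absence of nonparallel resonances on an irrational torus: every nondegenerate
resonant 4-tuple forms the vertices of an axis-parallel rectangle, namely
`(k₃, k₄) = ((k₁⁽¹⁾, k₂⁽²⁾), (k₂⁽¹⁾, k₁⁽²⁾))` or `(k₃, k₄) = ((k₂⁽¹⁾, k₁⁽²⁾), (k₁⁽¹⁾, k₂⁽²⁾))`. -/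
theorem stmt_6 (ω : ℝ × ℝ) (hω1 : 0 < ω.1) (hω2 : 0 < ω.2)
    (hirr : IsIrrationalPair ω) (k₁ k₂ k₃ k₄ : ℤ × ℤ)
    (h : InRes ω k₁ k₂ k₃ k₄) (hnd : ¬ Degenerate k₁ k₂ k₃ k₄) :
    (k₃ = (k₁.1, k₂.2) ∧ k₄ = (k₂.1, k₁.2)) ∨
    (k₃ = (k₂.1, k₁.2) ∧ k₄ = (k₁.1, k₂.2)) := by
  obtain ⟨hsq₁, hsq₂⟩ := h.sq_add_sq_eq hirr
  have h₁ := Int.eq_and_eq_or_eq_and_eq_of_add_eq_of_sq_add_sq_eq (congrArg Prod.fst h.1) hsq₁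
  have h₂ := Int.eq_and_eq_or_eq_and_eq_of_add_eq_of_sq_add_sq_eq (congrArg Prod.snd h.1) hsq₂
  simp only [Degenerate, Prod.ext_iff] at hnd ⊢
  tauto
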